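/- For every K ≥ 3, every T ≥ 1, every threshold τ ∈ ℝ, and every fixed-budget strategy π with budget T, there exists a K-armed bandit problem ν whose arm distributions are all Gaussian with unit variance and whose mean sequence is unimodal, such that the expected simple regret satisfies R̄_T^{ν,π} ≥ (1/8)·√( K / T ). -/

import Mathlib

open MeasureTheory Real

namespace TBP

/-- A `K`-armed bandit problem: a probability distribution on `ℝ` for each arm. -/
structure Bandit (K : ℕ) where
  dist : Fin K → Measure ℝ
  prob : ∀ k, IsProbabilityMeasure (dist k)

/-- The mean of arm `k`. -/
noncomputable def Bandit.mean {K : ℕ} (ν : Bandit K) (k : Fin K) : ℝ := ∫ x, x ∂ ν.dist k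

/-- The unstructured class `B`: all arm distributions are supported in `[0,1]`. -/
def Bandit.inB {K : ℕ} (ν : Bandit K) : Prop := ∀ k, ν.dist k (Set.Icc (0:ℝ) 1) = 1

/-- All arms are `σ²`-sub-Gaussian. -/
def Bandit.subG {K : ℕ} (σ : ℝ) (ν : Bandit K) : Prop :=
  ∀ k, ∀ t : ℝ, ∫ x, Real.exp (t * (x - ν.mean k)) ∂ ν.dist k ≤ Real.exp (σ ^ 2 * t ^ 2 / 2)

/-- All arms are Gaussian with variance `σ²`. -/
def Bandit.isGaussian {K : ℕ} (σ : ℝ) (ν : Bandit K) : Prop :=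
  ∃ m : Fin K → ℝ, ∀ k, ν.dist k = ProbabilityTheory.gaussianReal (m k) ⟨σ ^ 2, sq_nonneg σ⟩

/-- The monotone (nondecreasing means) shape constraint. -/
def Bandit.mono {K : ℕ} (ν : Bandit K) : Prop := Monotone ν.mean

/-- The unimodal shape constraint. -/
def Bandit.unimodal {K : ℕ} (ν : Bandit K) : Prop :=
  ∃ kstar : Fin K, (∀ i j : Fin K, i ≤ j → j ≤ kstar → ν.mean i ≤ ν.mean j) ∧
    (∀ i j : Fin K, kstar ≤ i → i ≤ j → ν.mean j ≤ ν.mean i)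

/-- The concave shape constraint: `μ_{k-1} + μ_{k+1} ≤ 2 μ_k` at interior indices. -/
def Bandit.concave {K : ℕ} (ν : Bandit K) : Prop :=
  ∀ k : ℕ, ∀ (h0 : 0 < k) (h1 : k + 1 < K),
    ν.mean ⟨k - 1, by omega⟩ + ν.mean ⟨k + 1, h1⟩ ≤ 2 * ν.mean ⟨k, by omega⟩

/-- A fixed-budget strategy with budget `T` on `K` arms: a measurable sampling policy
(choosing the next arm from past observations) and a measurable final classification. -/
structure Strategy (K T : ℕ) where
  policy : (t : ℕ) → (Fin t → ℝ) → Fin K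
  policy_meas : ∀ t, Measurable (policy t)
  decision : (Fin T → ℝ) → Fin K → Bool
  decision_meas : Measurable decision

/-- Law of the first `t` observations produced by playing `policy` on the bandit `ν`. -/
noncomputable def traj {K : ℕ} (ν : Bandit K) (policy : (t : ℕ) → (Fin t → ℝ) → Fin K) :
    (t : ℕ) → Measure (Fin t → ℝ)
  | 0 => Measure.dirac (fun i => Fin.elim0 i)
  | (t + 1) => (traj ν policy t).bind
      (fun h => (ν.dist (policy t h)).map (fun y => Fin.snoc h y))

/-- The true classification of arm `k` (`true` iff `μ_k ≥ τ`). -/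
noncomputable def trueQ {K : ℕ} (ν : Bandit K) (τ : ℝ) (k : Fin K) : Bool :=
  decide (τ ≤ ν.mean k)

/-- Simple regret of the classification `Qhat`: the largest gap `|τ - μ_k|` over misclassified
arms `k` (and `0` if there is none). -/
noncomputable def regret {K : ℕ} (ν : Bandit K) (τ : ℝ) (Qhat : Fin K → Bool) : ℝ :=
  ((Finset.univ.filter (fun k => Qhat k ≠ trueQ ν τ k)).sup
    (fun k => Real.toNNReal |τ - ν.mean k|) : NNReal)

/-- Expected simple regret of the strategy `π` on the bandit problem `ν`. -/
noncomputable def expRegret {K T : ℕ} (ν : Bandit K) (alg : Strategy K T) (τ : ℝ) : ℝ :=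
  ∫ h, regret ν τ (alg.decision h) ∂ (traj ν alg.policy T)

/-- Minimax expected simple regret over the class `C` of `K`-armed bandit problems. -/
noncomputable def minimax (K T : ℕ) (τ : ℝ) (C : Bandit K → Prop) : ℝ :=
  ⨅ alg : Strategy K T, ⨆ ν : {ν : Bandit K // C ν}, expRegret ν.1 alg τ


/-- Empirical mean of arm `k` under the Uniform strategy: averages the `⌊T/K⌋` samples of arm `k`
(samples of arm `k` are taken at the times `t` with `⌊t/⌊T/K⌋⌋ = k`). -/
noncomputable def uniformEmp (K T : ℕ) (k : Fin K) (h : Fin T → ℝ) : ℝ :=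
  (∑ t ∈ Finset.univ.filter (fun t : Fin T => (t : ℕ) / (T / K) = (k : ℕ)), h t) / (T / K : ℕ)

/-- The Uniform strategy: sample each arm `⌊T/K⌋` times and classify each arm by comparing its
sample mean to the threshold `τ`. -/
noncomputable def uniformStrategy (K T : ℕ) (hK : 0 < K) (τ : ℝ) : Strategy K T where
  policy := fun t _ => ⟨(t / (T / K)) % K, Nat.mod_lt _ hK⟩
  policy_meas := fun _ => measurable_const
  decision := fun h k => decide (τ ≤ uniformEmp K T k h)
  decision_meas := by
    apply measurable_pi_lambda
    intro k
    have hm : Measurable (fun h : Fin T → ℝ => uniformEmp K T k h) := by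
      unfold uniformEmp; fun_prop
    have hset : MeasurableSet {h : Fin T → ℝ | τ ≤ uniformEmp K T k h} :=
      measurableSet_le measurable_const hm
    have heq : (fun h : Fin T → ℝ => decide (τ ≤ uniformEmp K T k h))
        = fun h => if τ ≤ uniformEmp K T k h then true else false := by
      funext h
      by_cases hc : τ ≤ uniformEmp K T k h <;> simp [hc]
    rw [heq]
    exact Measurable.ite hset measurable_const measurable_const

end TBP

namespace TBP

open ProbabilityTheory

variable {K T : ℕ}

instance (ν : Bandit K) (k : Fin K) : IsProbabilityMeasure (ν.dist k) := ν.prob k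

/-- The reward distribution of the arm selected by `f`, as a Markov kernel on histories. -/
noncomputable def Bandit.rewardKernel {α : Type*} [MeasurableSpace α] (ν : Bandit K)
    (f : α → Fin K) (hf : Measurable f) : Kernel α ℝ :=
  (Kernel.ofFunOfCountable ν.dist).comap f hf

@[simp]
lemma Bandit.rewardKernel_apply {α : Type*} [MeasurableSpace α] (ν : Bandit K)
    (f : α → Fin K) (hf : Measurable f) (a : α) : ν.rewardKernel f hf a = ν.dist (f a) := rfl

instance {α : Type*} [MeasurableSpace α] (ν : Bandit K) (f : α → Fin K) (hf : Measurable f) :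
    IsMarkovKernel (ν.rewardKernel f hf) :=
  ⟨fun a => ν.prob (f a)⟩

lemma measurable_snoc (t : ℕ) :
    Measurable (fun p : (Fin t → ℝ) × ℝ => (Fin.snoc p.1 p.2 : Fin (t + 1) → ℝ)) := by
  refine measurable_pi_lambda _ fun i => ?_
  refine Fin.lastCases ?_ (fun j => ?_) i
  · simpa using measurable_snd
  · simpa [Function.comp_def] using (measurable_pi_apply j).comp measurable_fst

lemma traj_succ (ν : Bandit K) {p : (t : ℕ) → (Fin t → ℝ) → Fin K}
    (hp : ∀ t, Measurable (p t)) (t : ℕ) [SFinite (traj ν p t)] :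
    traj ν p (t + 1) = (traj ν p t ⊗ₘ ν.rewardKernel (p t) (hp t)).map
      (fun q => (Fin.snoc q.1 q.2 : Fin (t + 1) → ℝ)) := by
  have key : ∀ {s : Set (Fin (t + 1) → ℝ)}, MeasurableSet s → ∀ h : Fin t → ℝ,
      (ν.dist (p t h)).map (fun y => (Fin.snoc h y : Fin (t + 1) → ℝ)) s =
        ν.rewardKernel (p t) (hp t) h (Prod.mk h ⁻¹'
          ((fun q : (Fin t → ℝ) × ℝ => (Fin.snoc q.1 q.2 : Fin (t + 1) → ℝ)) ⁻¹' s)) := by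
    intro s hs h
    exact Measure.map_apply ((measurable_snoc t).comp measurable_prodMk_left) hs
  have hm : Measurable (fun h : Fin t → ℝ =>
      (ν.dist (p t h)).map (fun y => (Fin.snoc h y : Fin (t + 1) → ℝ))) := by
    refine Measure.measurable_of_measurable_coe _ fun s hs => ?_
    simp_rw [key hs]
    exact Kernel.measurable_kernel_prodMk_left (measurable_snoc t hs)
  ext s hs
  rw [traj, Measure.bind_apply hs hm.aemeasurable, Measure.map_apply (measurable_snoc t) hs,
    Measure.compProd_apply (measurable_snoc t hs)]
  simp_rw [key hs]

lemma isProbabilityMeasure_traj (ν : Bandit K) {p : (t : ℕ) → (Fin t → ℝ) → Fin K}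
    (hp : ∀ t, Measurable (p t)) (t : ℕ) : IsProbabilityMeasure (traj ν p t) := by
  induction t with
  | zero => rw [traj]; infer_instance
  | succ t ih =>
    rw [traj_succ ν hp]
    exact Measure.isProbabilityMeasure_map (measurable_snoc t).aemeasurable

lemma integrable_of_abs_le {α : Type*} [MeasurableSpace α] {μ : Measure α} [IsFiniteMeasure μ]
    {f : α → ℝ} {C : ℝ} (hf : Measurable f) (hC : ∀ x, |f x| ≤ C) : Integrable f μ :=
  Integrable.of_bound hf.aestronglyMeasurable C (Filter.Eventually.of_forall hC)

lemma integrable_exp_of_abs_le {α : Type*} [MeasurableSpace α] {μ : Measure α}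
    [IsFiniteMeasure μ] {f : α → ℝ} {C : ℝ} (hf : Measurable f) (hC : ∀ x, |f x| ≤ C) :
    Integrable (fun x => exp (f x)) μ :=
  integrable_of_abs_le (C := exp C) (by fun_prop) fun x => by
    rw [abs_of_pos (exp_pos _)]; exact exp_le_exp.2 (abs_le.1 (hC x)).2

lemma exp_neg_le_integral_exp {α : Type*} [MeasurableSpace α] {μ : Measure α}
    [IsProbabilityMeasure μ] {f : α → ℝ} {C : ℝ} (hf : Measurable f) (hC : ∀ x, |f x| ≤ C) :
    exp (-C) ≤ ∫ x, exp (f x) ∂μ := by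
  calc exp (-C) = ∫ _, exp (-C) ∂μ := by simp
    _ ≤ _ := integral_mono (integrable_const _) (integrable_exp_of_abs_le hf hC)
        fun x => exp_le_exp.2 (abs_le.1 (hC x)).1

lemma integral_exp_pos_of_abs_le {α : Type*} [MeasurableSpace α] {μ : Measure α}
    [IsProbabilityMeasure μ] {f : α → ℝ} {C : ℝ} (hf : Measurable f) (hC : ∀ x, |f x| ≤ C) :
    0 < ∫ x, exp (f x) ∂μ :=
  (exp_pos _).trans_le (exp_neg_le_integral_exp hf hC)

lemma abs_log_integral_exp_le {α : Type*} [MeasurableSpace α] {μ : Measure α}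
    [IsProbabilityMeasure μ] {f : α → ℝ} {C : ℝ} (hf : Measurable f) (hC : ∀ x, |f x| ≤ C) :
    |log (∫ x, exp (f x) ∂μ)| ≤ C := by
  have hpos := integral_exp_pos_of_abs_le (μ := μ) hf hC
  rw [abs_le, le_log_iff_exp_le hpos, log_le_iff_le_exp hpos]
  refine ⟨exp_neg_le_integral_exp hf hC, ?_⟩
  calc ∫ x, exp (f x) ∂μ ≤ ∫ _, exp C ∂μ :=
        integral_mono (integrable_exp_of_abs_le hf hC) (integrable_const _)
          fun x => exp_le_exp.2 (abs_le.1 (hC x)).2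
    _ = exp C := by simp

/-- The Donsker–Varadhan inequality between `μ` and `μ'` for bounded test functions, with `d` in
place of the relative entropy of `μ` with respect to `μ'`. -/
def EntropyLE {α : Type*} [MeasurableSpace α] (μ μ' : Measure α) (d : ℝ) : Prop :=
  ∀ ⦃f : α → ℝ⦄, Measurable f → (∃ C, ∀ x, |f x| ≤ C) →
    ∫ x, f x ∂μ ≤ d + log (∫ x, exp (f x) ∂μ')

lemma exp_integral_le_integral_exp {α : Type*} [MeasurableSpace α] {μ : Measure α}
    [IsProbabilityMeasure μ] {f : α → ℝ} (hf : Integrable f μ)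
    (hf' : Integrable (fun x => exp (f x)) μ) : exp (∫ x, f x ∂μ) ≤ ∫ x, exp (f x) ∂μ :=
  convexOn_exp.map_integral_le continuous_exp.continuousOn isClosed_univ
    (Filter.Eventually.of_forall fun _ => Set.mem_univ _) hf hf'

lemma entropyLE_self {α : Type*} [MeasurableSpace α] (μ : Measure α) [IsProbabilityMeasure μ] :
    EntropyLE μ μ 0 := by
  rintro f hf ⟨C, hC⟩
  rw [zero_add, le_log_iff_exp_le (integral_exp_pos_of_abs_le hf hC)]
  exact exp_integral_le_integral_exp (integrable_of_abs_le hf hC) (integrable_exp_of_abs_le hf hC)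

lemma integral_gaussianReal_add (m δ : ℝ) (f : ℝ → ℝ) :
    ∫ x, f x ∂(gaussianReal (m + δ) 1) =
      ∫ x, exp (δ * (x - m) - δ ^ 2 / 2) * f x ∂(gaussianReal m 1) := by
  rw [integral_gaussianReal_eq_integral_smul one_ne_zero,
    integral_gaussianReal_eq_integral_smul one_ne_zero]
  congr 1 with x
  simp only [gaussianPDFReal_def, smul_eq_mul, NNReal.coe_one, mul_assoc]
  rw [← mul_assoc (exp (-(x - m) ^ 2 / _)), ← exp_add]
  congr 3
  ring

lemma entropyLE_gaussianReal (m δ : ℝ) :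
    EntropyLE (gaussianReal m 1) (gaussianReal (m + δ) 1) (δ ^ 2 / 2) := by
  rintro f hf ⟨C, hC⟩
  have hid : Integrable (fun x : ℝ => x) (gaussianReal m 1) :=
    (memLp_id_gaussianReal 1).integrable le_rfl
  have hmul : Integrable (fun x => δ * (x - m)) (gaussianReal m 1) :=
    (hid.sub (integrable_const m)).const_mul δ
  have hlin : Integrable (fun x => δ * (x - m) - δ ^ 2 / 2) (gaussianReal m 1) :=
    hmul.sub (integrable_const _)
  have hfi : Integrable f (gaussianReal m 1) := integrable_of_abs_le hf hC
  have hexp : Integrable (fun x => exp (δ * (x - m) - δ ^ 2 / 2 + f x)) (gaussianReal m 1) := by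
    refine Integrable.mono' ((integrable_exp_mul_gaussianReal (μ := m) (v := 1) δ).const_mul
      (exp (-(δ * m) - δ ^ 2 / 2 + C))) (by fun_prop) (Filter.Eventually.of_forall fun x => ?_)
    rw [norm_eq_abs, abs_of_pos (exp_pos _), ← exp_add]
    exact exp_le_exp.2 (by linarith [(abs_le.1 (hC x)).2])
  have hlog : ∫ x, f x ∂(gaussianReal m 1) - δ ^ 2 / 2 =
      ∫ x, (δ * (x - m) - δ ^ 2 / 2 + f x) ∂(gaussianReal m 1) := by
    rw [integral_add hlin hfi, integral_sub hmul (integrable_const _), integral_const_mul,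
      integral_sub hid (integrable_const m),
      integral_id_gaussianReal]
    simp
    ring
  rw [← sub_le_iff_le_add', le_log_iff_exp_le (integral_exp_pos_of_abs_le hf hC), hlog,
    integral_gaussianReal_add]
  simp_rw [← exp_add]
  exact exp_integral_le_integral_exp (hlin.add hfi) hexp

/-- Chain rule for the divergence between the laws of the observations under two bandits. -/
theorem entropyLE_traj {ν ν' : Bandit K} {d : Fin K → ℝ}
    (hd : ∀ k, EntropyLE (ν.dist k) (ν'.dist k) (d k)) {p : (t : ℕ) → (Fin t → ℝ) → Fin K}
    (hp : ∀ t, Measurable (p t)) (t : ℕ) :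
    EntropyLE (traj ν p t) (traj ν' p t)
      (∑ s ∈ Finset.range t, ∫ h, d (p s h) ∂(traj ν p s)) := by
  induction t with
  | zero =>
    simp only [traj, Finset.range_zero, Finset.sum_empty]
    exact entropyLE_self _
  | succ t ih =>
    rintro f hf ⟨C, hC⟩
    have := isProbabilityMeasure_traj ν hp t
    have := isProbabilityMeasure_traj ν' hp t
    set F : (Fin t → ℝ) × ℝ → ℝ := fun q => f (Fin.snoc q.1 q.2) with hF
    have hFm : Measurable F := hf.comp (measurable_snoc t)
    have hFC : ∀ q, |F q| ≤ C := fun q => hC _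
    have hFh : ∀ h, Measurable fun y => F (h, y) := fun h => hFm.comp measurable_prodMk_left
    set G : (Fin t → ℝ) → ℝ := fun h => log (∫ y, exp (F (h, y)) ∂(ν'.dist (p t h))) with hG
    have hG_meas : Measurable G := by
      refine measurable_log.comp ?_
      exact (StronglyMeasurable.integral_kernel_prod_right'
        (κ := ν'.rewardKernel (p t) (hp t)) (f := fun q => exp (F q))
        (measurable_exp.comp hFm).stronglyMeasurable).measurable
    have hGC : ∀ h, |G h| ≤ C := fun h => abs_log_integral_exp_le (hFh h) fun y => hFC _
    have hd_int : Integrable (fun h => d (p t h)) (traj ν p t) :=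
      integrable_of_abs_le (C := ∑ k, |d k|) ((measurable_of_countable d).comp (hp t))
        fun h => Finset.single_le_sum (f := fun k => |d k|) (fun _ _ => abs_nonneg _)
          (Finset.mem_univ _)
    have hleft : ∫ x, f x ∂(traj ν p (t + 1)) =
        ∫ h, ∫ y, F (h, y) ∂(ν.dist (p t h)) ∂(traj ν p t) := by
      rw [traj_succ ν hp, integral_map (measurable_snoc t).aemeasurable
        hf.aestronglyMeasurable]
      exact Measure.integral_compProd (integrable_of_abs_le hFm hFC)
    have hright : ∫ x, exp (f x) ∂(traj ν' p (t + 1)) = ∫ h, exp (G h) ∂(traj ν' p t) := by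
      rw [traj_succ ν' hp, integral_map (measurable_snoc t).aemeasurable (by fun_prop),
        Measure.integral_compProd (integrable_exp_of_abs_le hFm hFC)]
      refine integral_congr_ae (Filter.Eventually.of_forall fun h => ?_)
      exact (exp_log (integral_exp_pos_of_abs_le (hFh h) fun y => hFC _)).symm
    have hstep : ∫ h, ∫ y, F (h, y) ∂(ν.dist (p t h)) ∂(traj ν p t) ≤
        ∫ h, (d (p t h) + G h) ∂(traj ν p t) := by
      refine integral_mono ?_ (hd_int.add (integrable_of_abs_le hG_meas hGC)) fun h =>
        hd (p t h) (hFh h) ⟨C, fun y => hFC _⟩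
      refine integrable_of_abs_le (C := C) (StronglyMeasurable.integral_kernel_prod_right'
        (κ := ν.rewardKernel (p t) (hp t)) hFm.stronglyMeasurable).measurable fun h => ?_
      simpa using norm_integral_le_of_norm_le_const (μ := ν.dist (p t h))
        (f := fun y => F (h, y)) (C := C)
        (Filter.Eventually.of_forall fun y => hFC (h, y))
    rw [integral_add hd_int (integrable_of_abs_le hG_meas hGC)] at hstep
    rw [Finset.sum_range_succ, hleft, hright]
    linarith [ih hG_meas ⟨C, hGC⟩]

/-- Pinsker's inequality in linearised form. -/
lemma EntropyLE.measureReal_le {α : Type*} [MeasurableSpace α] {μ μ' : Measure α}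
    [IsProbabilityMeasure μ] [IsProbabilityMeasure μ'] {d : ℝ} (h : EntropyLE μ μ' d)
    {s : Set α} (hs : MeasurableSet s) {c : ℝ} (hc : 0 < c) :
    μ.real s ≤ μ'.real s + c / 8 + d / c := by
  have hX : Measurable (s.indicator (1 : α → ℝ)) := measurable_one.indicator hs
  have h01 : ∀ x, s.indicator (1 : α → ℝ) x ∈ Set.Icc (0 : ℝ) 1 := fun x => by
    by_cases hx : x ∈ s <;> simp [hx]
  have hC : ∀ x, |c * s.indicator (1 : α → ℝ) x| ≤ c := fun x => by
    rw [abs_mul, abs_of_pos hc, abs_of_nonneg (h01 x).1]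
    exact mul_le_of_le_one_right hc.le (h01 x).2
  have hDV := h (hX.const_mul c) ⟨c, hC⟩
  have hH := (hasSubgaussianMGF_of_mem_Icc (μ := μ') hX.aemeasurable
    (Filter.Eventually.of_forall h01)).mgf_le c
  rw [integral_const_mul, integral_indicator_one hs] at hDV
  simp only [integral_indicator_one hs, mgf] at hH
  have hlog : log (∫ x, exp (c * s.indicator (1 : α → ℝ) x) ∂μ') ≤
      c * μ'.real s + c ^ 2 / 8 := by
    rw [log_le_iff_le_exp (integral_exp_pos_of_abs_le (hX.const_mul c) hC)]
    have : ∀ x, exp (c * (s.indicator (1 : α → ℝ) x - μ'.real s)) =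
        exp (c * s.indicator (1 : α → ℝ) x) * exp (-(c * μ'.real s)) := fun x => by
      rw [← exp_add]; ring_nf
    simp_rw [this] at hH
    rw [integral_mul_const] at hH
    have hH' := mul_le_mul_of_nonneg_right hH (exp_pos (c * μ'.real s)).le
    rw [mul_assoc, ← exp_add, ← exp_add] at hH'
    refine (le_of_eq (by simp)).trans (hH'.trans (exp_le_exp.2 (le_of_eq ?_)))
    simp
    ring
  have : c * μ.real s ≤ c * (μ'.real s + c / 8 + d / c) := by
    have : c * (μ'.real s + c / 8 + d / c) = c * μ'.real s + c ^ 2 / 8 + d := by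
      field_simp
    linarith
  exact le_of_mul_le_mul_left this hc

/-- The bandit problem with unit-variance Gaussian arms of means `m`. -/
noncomputable def gaussianBandit (m : Fin K → ℝ) : Bandit K where
  dist k := gaussianReal (m k) 1
  prob _ := inferInstance

lemma gaussianBandit_mean (m : Fin K → ℝ) (k : Fin K) : (gaussianBandit m).mean k = m k :=
  integral_id_gaussianReal

lemma gaussianBandit_isGaussian (m : Fin K → ℝ) : (gaussianBandit m).isGaussian 1 := by
  refine ⟨m, fun k => ?_⟩
  change gaussianReal (m k) 1 = _
  congr 1
  exact NNReal.eq (one_pow 2).symm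

lemma abs_sub_mean_le_regret {ν : Bandit K} {τ : ℝ} {q : Fin K → Bool} {k : Fin K}
    (hk : q k ≠ trueQ ν τ k) : |τ - ν.mean k| ≤ regret ν τ q := by
  rw [← Real.coe_toNNReal _ (abs_nonneg (τ - ν.mean k)), regret, NNReal.coe_le_coe]
  exact Finset.le_sup (f := fun k => Real.toNNReal |τ - ν.mean k|) (by simpa using hk)

lemma Strategy.measurableSet_decision (alg : Strategy K T) (k : Fin K) (b : Bool) :
    MeasurableSet {h | alg.decision h k = b} :=
  ((measurable_pi_apply k).comp alg.decision_meas) (measurableSet_singleton b)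

/-- Markov-type bound: misclassifying arm `k` costs at least its gap. -/
lemma gap_mul_measureReal_le_expRegret (ν : Bandit K) (alg : Strategy K T) (τ : ℝ) (k : Fin K)
    {b : Bool} (hb : b ≠ trueQ ν τ k) :
    |τ - ν.mean k| * (traj ν alg.policy T).real {h | alg.decision h k = b} ≤
      expRegret ν alg τ := by
  have := isProbabilityMeasure_traj ν alg.policy_meas T
  have hs := alg.measurableSet_decision k b
  obtain ⟨C, hC⟩ := (Set.finite_range fun q : Fin K → Bool => |regret ν τ q|).bddAbove
  have hint : Integrable (fun h => regret ν τ (alg.decision h)) (traj ν alg.policy T) :=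
    integrable_of_abs_le ((measurable_of_countable (regret ν τ)).comp alg.decision_meas)
      fun h => hC ⟨alg.decision h, rfl⟩
  rw [mul_comm, ← smul_eq_mul, ← integral_indicator_const |τ - ν.mean k| hs]
  refine integral_mono ((integrable_const _).indicator hs) hint fun h => ?_
  refine Set.indicator_le' (g := fun h => regret ν τ (alg.decision h)) (f := fun _ => |τ - ν.mean k|) (fun h hh => ?_) (fun h _ => ?_) h
  · exact abs_sub_mean_le_regret ((show alg.decision h k = b from hh) ▸ hb)
  · exact NNReal.coe_nonneg _

/-- Some arm is pulled at most `T / K` times in expectation. -/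
lemma exists_sum_measureReal_le (ν : Bandit K) (hK : 0 < K)
    {p : (t : ℕ) → (Fin t → ℝ) → Fin K} (hp : ∀ t, Measurable (p t)) (T : ℕ) :
    ∃ k, ∑ s ∈ Finset.range T, (traj ν p s).real (p s ⁻¹' {k}) ≤ T / K := by
  have : Nonempty (Fin K) := ⟨⟨0, hK⟩⟩
  have hK' : (K : ℝ) ≠ 0 := by exact_mod_cast hK.ne'
  have hsum : ∑ k, ∑ s ∈ Finset.range T, (traj ν p s).real (p s ⁻¹' {k}) = T := by
    rw [Finset.sum_comm]
    calc _ = ∑ s ∈ Finset.range T, (1 : ℝ) := Finset.sum_congr rfl fun s _ => by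
          have := isProbabilityMeasure_traj ν hp s
          rw [sum_measureReal_preimage_singleton _ fun k _ => hp s (measurableSet_singleton k)]
          simp
      _ = T := by simp
  obtain ⟨k, -, hk⟩ := Finset.exists_le_of_sum_le (s := Finset.univ)
    (f := fun k => ∑ s ∈ Finset.range T, (traj ν p s).real (p s ⁻¹' {k}))
    (g := fun _ : Fin K => (T : ℝ) / K) Finset.univ_nonempty
    (by rw [hsum]; simp [mul_div_cancel₀ _ hK'])
  exact ⟨k, hk⟩

end TBP

open TBP in
/-- Minimax lower bound for the unimodal thresholding bandit problem. -/
theorem unimodal_lower_bound (K T : ℕ) (τ : ℝ) (hK : 3 ≤ K) (hT : 1 ≤ T)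
    (alg : Strategy K T) :
    ∃ ν : Bandit K, ν.isGaussian 1 ∧ ν.unimodal ∧
      1 / 8 * Real.sqrt (K / T) ≤ expRegret ν alg τ := by
  set Δ : ℝ := √(K / T) / 2 with hΔ
  have hK0 : (0 : ℝ) < K := by exact_mod_cast (by omega : 0 < K)
  have hT0 : (0 : ℝ) < T := by exact_mod_cast hT
  have hΔ0 : 0 < Δ := by positivity
  set ν₀ : Bandit K := gaussianBandit fun _ => τ - Δ with hν₀
  obtain ⟨k, hk⟩ := exists_sum_measureReal_le ν₀ (by omega) alg.policy_meas T
  set ν₁ : Bandit K := gaussianBandit fun j => τ - Δ + if j = k then 2 * Δ else 0 with hν₁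
  have hmean₀ : ∀ j, ν₀.mean j = τ - Δ := gaussianBandit_mean _
  have hmean₁ : ∀ j, ν₁.mean j = τ - Δ + if j = k then 2 * Δ else 0 := gaussianBandit_mean _
  have := isProbabilityMeasure_traj ν₀ alg.policy_meas T
  have := isProbabilityMeasure_traj ν₁ alg.policy_meas T
  have hent := entropyLE_traj (ν := ν₀) (ν' := ν₁)
    (d := fun j => (if j = k then 2 * Δ else 0) ^ 2 / 2)
    (fun j => entropyLE_gaussianReal _ _) alg.policy_meas T
  have hd : ∑ s ∈ Finset.range T, ∫ h, (if alg.policy s h = k then 2 * Δ else 0) ^ 2 / 2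
      ∂(traj ν₀ alg.policy s) ≤ 1 / 2 := by
    have heq : ∀ s, ∫ h, (if alg.policy s h = k then 2 * Δ else 0) ^ 2 / 2
        ∂(traj ν₀ alg.policy s) =
        2 * Δ ^ 2 * (traj ν₀ alg.policy s).real (alg.policy s ⁻¹' {k}) := fun s => by
      rw [mul_comm (2 * Δ ^ 2), ← smul_eq_mul (_ : ℝ) (2 * Δ ^ 2), ← integral_indicator_const _
        (alg.policy_meas s (measurableSet_singleton k))]
      congr 1 with h
      by_cases hh : alg.policy s h = k
      · simp [hh]; ring
      · simp [hh]
    simp_rw [heq, ← Finset.mul_sum]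
    refine (mul_le_mul_of_nonneg_left hk (by positivity)).trans (le_of_eq ?_)
    rw [hΔ, div_pow, sq_sqrt (by positivity)]
    field_simp
  have hpin := hent.measureReal_le (alg.measurableSet_decision k false) two_pos
  have hcompl : (traj ν₀ alg.policy T).real {h | alg.decision h k = true} =
      1 - (traj ν₀ alg.policy T).real {h | alg.decision h k = false} := by
    rw [← probReal_compl_eq_one_sub (alg.measurableSet_decision k false)]
    congr 1 with h
    simp
  have h₀ := gap_mul_measureReal_le_expRegret ν₀ alg τ k (b := true)
    (by simp [trueQ, hmean₀, hΔ0])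
  have h₁ := gap_mul_measureReal_le_expRegret ν₁ alg τ k (b := false) (by
    simp only [trueQ, hmean₁, if_true]
    rw [decide_eq_true (by linarith)]
    simp)
  rw [hmean₀, sub_sub_cancel, abs_of_pos hΔ0, hcompl] at h₀
  rw [hmean₁, if_pos rfl, show τ - (τ - Δ + 2 * Δ) = -Δ by ring, abs_neg, abs_of_pos hΔ0] at h₁
  have hgoal : 1 / 8 * √(K / T) = Δ / 4 := by rw [hΔ]; ring
  rw [hgoal]
  by_cases hcase : 1 / 4 ≤ (traj ν₁ alg.policy T).real {h | alg.decision h k = false}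
  · refine ⟨ν₁, gaussianBandit_isGaussian _, ⟨k, fun i j hij hj => ?_, fun i j hi hij => ?_⟩, ?_⟩
    · rw [hmean₁, hmean₁]
      by_cases hik : i = k
      · rw [hik, le_antisymm hj (hik ▸ hij)]
      · rw [if_neg hik]; split_ifs <;> linarith
    · rw [hmean₁, hmean₁]
      by_cases hik : j = k
      · rw [hik, le_antisymm (hik ▸ hij) hi]
      · rw [if_neg hik]; split_ifs <;> linarith
    · nlinarith
  · refine ⟨ν₀, gaussianBandit_isGaussian _, ⟨k, fun i j _ _ => ?_, fun i j _ _ => ?_⟩, ?_⟩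
    · rw [hmean₀, hmean₀]
    · rw [hmean₀, hmean₀]
    · push Not at hcase
      have : (1 : ℝ) / 4 ≤ 1 - (traj ν₀ alg.policy T).real {h | alg.decision h k = false} := by
        linarith
      nlinarith
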